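/- Kamioka's norm-trace generating function formula (Theorem 1.1): for all nonnegative integers r, c, n, the following identity holds in ℚ(a,q): the sum over all plane partitions π in P(r,c,n) of q^{|π|} · a^{tr(π)} · ∏_{k=1}^{π_{1,1}} (q^{n-k+1};q)_{D_k(π)} / (a q^{n-k+1};q)_{D_k(π)} equals the triple product ∏_{i=1}^{r} ∏_{j=1}^{c} ∏_{k=1}^{n} (1 - a q^{i+j+k-1}) / (1 - a q^{i+j+k-2}). -/

import Mathlib

open Finset

noncomputable section

/-- The field `ℚ(a,q)` of rational functions in two indeterminates over `ℚ`. -/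
abbrev Kaq : Type := FractionRing (MvPolynomial (Fin 2) ℚ)

/-- The indeterminate `a` in `ℚ(a,q)`. -/
def av : Kaq := algebraMap (MvPolynomial (Fin 2) ℚ) Kaq (MvPolynomial.X 0)

/-- The indeterminate `q` in `ℚ(a,q)`. -/
def qv : Kaq := algebraMap (MvPolynomial (Fin 2) ℚ) Kaq (MvPolynomial.X 1)

/-- A plane partition with at most `r` rows and at most `c` columns, viewed as a map
`ℕ≥1 × ℕ≥1 → ℕ` (encoded as a map `ℕ × ℕ → ℕ` vanishing at indices `0`), weakly
decreasing along rows and columns, with `π i j = 0` whenever `i > r` or `j > c`. -/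
def IsPlanePartition (r c : ℕ) (π : ℕ → ℕ → ℕ) : Prop :=
  (∀ i j, 1 ≤ i → 1 ≤ j → π i (j + 1) ≤ π i j) ∧
  (∀ i j, 1 ≤ i → 1 ≤ j → π (i + 1) j ≤ π i j) ∧
  (∀ i j, r < i ∨ c < j → π i j = 0) ∧
  (∀ i j, i = 0 ∨ j = 0 → π i j = 0)

/-- `P(r,c,n)`: plane partitions with at most `r` rows, at most `c` columns,
and all parts at most `n`. -/
def boxPP (r c n : ℕ) : Set (ℕ → ℕ → ℕ) :=
  {π | IsPlanePartition r c π ∧ ∀ i j, π i j ≤ n}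

/-- The norm `|π| = Σ_{i,j} π_{i,j}` of a plane partition. -/
def ppNorm (π : ℕ → ℕ → ℕ) : ℕ := ∑ᶠ i, ∑ᶠ j, π i j

/-- The trace `tr(π) = Σ_i π_{i,i}` of a plane partition. -/
def ppTrace (π : ℕ → ℕ → ℕ) : ℕ := ∑ᶠ i, π i i

/-- `D_k(π) = max {s : π_{s,s} ≥ k}`, the side length of the Durfee square of the
`k`-cross section of `π` (with `D_k(π) = 0` if `π_{1,1} < k`). -/
def durfee (π : ℕ → ℕ → ℕ) (k : ℕ) : ℕ := sSup {s | k ≤ π s s}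

/-- The q-Pochhammer symbol `(x; q)_N = ∏_{m=0}^{N-1} (1 - x qᵐ)`. -/
def poch {K : Type*} [Field K] (x q : K) (N : ℕ) : K :=
  ∏ m ∈ Finset.range N, (1 - x * q ^ m)

section Rows
variable {K : Type*} [Field K]

/-- The weight of the first `l` cells of row `i` (rows and columns counted from `0`). -/
def rowWeight (n : ℕ) (q b : K) (i l : ℕ) : K :=
  ∏ j ∈ range l, (1 - q ^ (n + i - j)) / (1 - b * q ^ (n + i - j))

variable {n : ℕ} {q b : K}

lemma one_sub_pow_ne (hq : ∀ m, 1 - q ^ (m + 1) ≠ 0) {m : ℕ} (hm : 0 < m) : 1 - q ^ m ≠ 0 := by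
  obtain ⟨k, rfl⟩ := Nat.exists_eq_succ_of_ne_zero hm.ne'
  exact hq k

lemma one_sub_mul_pow_ne (hb : ∀ m, 1 - b * q ^ (m + 1) ≠ 0) {m : ℕ} (hm : 0 < m) :
    1 - b * q ^ m ≠ 0 := by
  obtain ⟨k, rfl⟩ := Nat.exists_eq_succ_of_ne_zero hm.ne'
  exact hb k

lemma one_sub_shift_ne (hb : ∀ m, 1 - b * q ^ (m + 1) ≠ 0) (m : ℕ) :
    1 - b * q * q ^ (m + 1) ≠ 0 := by
  have := hb (m + 1)
  rwa [pow_succ', ← mul_assoc] at this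

lemma rowWeight_zero (i : ℕ) : rowWeight n q b i 0 = 1 := by simp [rowWeight]

lemma rowWeight_succ (i l : ℕ) : rowWeight n q b i (l + 1) =
    rowWeight n q b i l * ((1 - q ^ (n + i - l)) / (1 - b * q ^ (n + i - l))) :=
  prod_range_succ _ _

lemma rowWeight_ne_zero (hq : ∀ m, 1 - q ^ (m + 1) ≠ 0) (hb : ∀ m, 1 - b * q ^ (m + 1) ≠ 0)
    (i : ℕ) {l : ℕ} (hl : l ≤ n) : rowWeight n q b i l ≠ 0 := by
  refine prod_ne_zero_iff.2 fun j hj => ?_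
  have : j < l := mem_range.1 hj
  exact div_ne_zero (one_sub_pow_ne hq (by omega)) (one_sub_mul_pow_ne hb (by omega))

lemma rowWeight_mul_shift (hb : ∀ m, 1 - b * q ^ (m + 1) ≠ 0) (i : ℕ) {l : ℕ} (hl : l ≤ n) :
    rowWeight n q b i l * (1 - b * q ^ (n + i + 1 - l)) =
      rowWeight n q (b * q) i l * (1 - b * q ^ (n + i + 1)) := by
  induction l with
  | zero => simp [rowWeight_zero]
  | succ l ih =>
    have ih := ih (by omega)
    obtain ⟨s, hs⟩ : ∃ s, n + i - l = s + 1 := ⟨n + i - l - 1, by omega⟩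
    have h2 : n + i + 1 - l = s + 2 := by omega
    have h3 : n + i + 1 - (l + 1) = s + 1 := by omega
    have e3 : b * q * q ^ (s + 1) = b * q ^ (s + 2) := by ring
    have e4 := div_mul_cancel₀ (1 - q ^ (s + 1)) (hb (s + 1))
    rw [rowWeight_succ, rowWeight_succ, hs, h3, mul_assoc, div_mul_cancel₀ _ (hb s), e3]
    rw [h2] at ih
    linear_combination (1 - q ^ (s + 1)) / (1 - b * q ^ (s + 2)) * ih - rowWeight n q b i l * e4

lemma rowWeight_succ_row (i : ℕ) {l : ℕ} (hl : l ≤ n) :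
    rowWeight n q b (i + 1) l * (1 - q ^ (n + i + 1 - l)) =
      rowWeight n q (b * q) i l * (1 - q ^ (n + i + 1)) := by
  induction l with
  | zero => simp [rowWeight_zero]
  | succ l ih =>
    have ih := ih (by omega)
    obtain ⟨s, hs⟩ : ∃ s, n + i - l = s + 1 := ⟨n + i - l - 1, by omega⟩
    have h1 : n + (i + 1) - l = s + 2 := by omega
    have h2 : n + i + 1 - l = s + 2 := by omega
    have h3 : n + i + 1 - (l + 1) = s + 1 := by omega
    rw [rowWeight_succ, rowWeight_succ, hs, h1, h3]
    rw [h2] at ih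
    have e3 : b * q * q ^ (s + 1) = b * q ^ (s + 2) := by ring
    rw [e3]
    linear_combination (1 - q ^ (s + 1)) / (1 - b * q ^ (s + 2)) * ih

lemma one_sub_mul_sum_rowWeight (hb : ∀ m, 1 - b * q ^ (m + 1) ≠ 0) (i : ℕ) {B A : ℕ}
    (hBA : B ≤ A) (hA : A ≤ n) :
    (1 - b * q) * ∑ l ∈ Icc B A, (b * q) ^ l * rowWeight n q b i l =
      (b * q) ^ B * rowWeight n q b i B * (1 - b * q ^ (n + i + 1 - B)) -
        (b * q) ^ (A + 1) * rowWeight n q b i A * (1 - q ^ (n + i - A)) := by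
  induction A, hBA using Nat.le_induction with
  | base =>
    have h : n + i + 1 - B = n + i - B + 1 := by omega
    rw [Icc_self, sum_singleton, h]
    ring
  | succ A hBA ih =>
    rw [← insert_Icc_right_eq_Icc_add_one (by omega), sum_insert (by simp), mul_add, ih (by omega)]
    obtain ⟨s, hs⟩ : ∃ s, n + i - A = s + 1 := ⟨n + i - A - 1, by omega⟩
    have h1 : n + i - (A + 1) = s := by omega
    rw [rowWeight_succ, hs, h1]
    have e1 := hb s
    field_simp
    ring

lemma one_sub_mul_sum_inv_rowWeight (hq0 : q ≠ 0) (hb0 : b ≠ 0)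
    (hq : ∀ m, 1 - q ^ (m + 1) ≠ 0) (hb : ∀ m, 1 - b * q ^ (m + 1) ≠ 0) (i : ℕ) {B A : ℕ}
    (hBA : B ≤ A) (hA : A ≤ n) :
    (1 - b * q) * ∑ k ∈ Icc B A, ((b * q) ^ k * rowWeight n q (b * q * q) i k)⁻¹ =
      ((b * q) ^ A * rowWeight n q (b * q * q) i A)⁻¹ * (1 - b * q ^ (n + i + 2 - A)) -
        b * q * ((b * q) ^ B * rowWeight n q (b * q * q) i B)⁻¹ * (1 - q ^ (n + i + 1 - B)) := by
  induction A, hBA using Nat.le_induction with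
  | base =>
    have h : n + i + 2 - B = n + i + 1 - B + 1 := by omega
    rw [Icc_self, sum_singleton, h]
    ring
  | succ A hBA ih =>
    rw [← insert_Icc_right_eq_Icc_add_one (by omega), sum_insert (by simp), mul_add, ih (by omega)]
    obtain ⟨s, hs⟩ : ∃ s, n + i - A = s + 1 := ⟨n + i - A - 1, by omega⟩
    have h1 : n + i + 2 - (A + 1) = s + 2 := by omega
    have h2 : n + i + 2 - A = s + 3 := by omega
    have hw := rowWeight_ne_zero (n := n) hq (one_sub_shift_ne (one_sub_shift_ne hb)) i
      (show A ≤ n by omega)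
    rw [rowWeight_succ, hs, h1, h2]
    have e1 := hq s
    have e2 := hb (s + 2)
    have e3 : b * q * q * q ^ (s + 1) = b * q ^ (s + 3) := by ring
    rw [e3]
    field_simp
    ring

/-- The first row of the local move. -/
lemma sum_rowWeight_first (hb : ∀ m, 1 - b * q ^ (m + 1) ≠ 0)
    {B : ℕ} (hB : B ≤ n) :
    ∑ l ∈ Icc B n, (b * q) ^ l * rowWeight n q b 0 l =
      (1 - b * q ^ (n + 1)) / (1 - b * q) * ((b * q) ^ B * rowWeight n q (b * q) 0 B) := by
  have h := one_sub_mul_sum_rowWeight hb 0 hB le_rfl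
  have h2 := rowWeight_mul_shift hb 0 hB
  have h0 : 1 - b * q ≠ 0 := by simpa using hb 0
  simp only [add_zero, Nat.sub_self, pow_zero, sub_self, mul_zero, sub_zero] at h h2
  field_simp
  linear_combination h + (b * q) ^ B * h2

/-- The remaining rows of the local move. -/
lemma sum_rowWeight_succ (hq0 : q ≠ 0) (hb0 : b ≠ 0)
    (hq : ∀ m, 1 - q ^ (m + 1) ≠ 0) (hb : ∀ m, 1 - b * q ^ (m + 1) ≠ 0) (i : ℕ) {B A : ℕ}
    (hA : A ≤ n) :
    ∑ l ∈ Icc B A, (b * q) ^ l * rowWeight n q b (i + 1) l =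
      ((b * q) ^ A * rowWeight n q (b * q) i A) * ((b * q) ^ B * rowWeight n q (b * q) (i + 1) B) *
        ∑ k ∈ Icc B A, ((b * q) ^ k * rowWeight n q (b * q * q) i k)⁻¹ := by
  rcases lt_or_ge A B with hBA | hBA
  · simp [Icc_eq_empty_of_lt hBA]
  have h0 : 1 - b * q ≠ 0 := by simpa using hb 0
  have hb1 := one_sub_shift_ne hb
  have hb2 := one_sub_shift_ne hb1
  have hB := hBA.trans hA
  apply mul_left_cancel₀ h0
  rw [mul_left_comm (1 - b * q), one_sub_mul_sum_inv_rowWeight hq0 hb0 hq hb i hBA hA,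
    one_sub_mul_sum_rowWeight hb (i + 1) hBA hA]
  have s1 := rowWeight_mul_shift hb (i + 1) hB
  have s2 := rowWeight_mul_shift hb1 i hA
  have s3 := rowWeight_succ_row (q := q) (b := b) i hA
  have s4 := rowWeight_succ_row (q := q) (b := b * q) i hB
  have wA := rowWeight_ne_zero (n := n) hq hb2 i hA
  have wB := rowWeight_ne_zero (n := n) hq hb2 i hB
  have e1 : n + (i + 1) + 1 - B = n + i + 2 - B := by omega
  have e2 : n + (i + 1) - A = n + i + 1 - A := by omega
  have e3 : b * q * q ^ (n + i + 1 - A) = b * q ^ (n + i + 2 - A) := by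
    rw [show n + i + 2 - A = n + i + 1 - A + 1 by omega]; ring
  have e4 : b * q * q ^ (n + i + 1) = b * q ^ (n + i + 2) := by ring
  have n1 := hb (n + i + 1)
  have n2 := hq (n + i)
  rw [e1, show n + (i + 1) + 1 = n + i + 2 by ring] at s1
  rw [e3, e4] at s2
  rw [e1, e2]
  generalize rowWeight n q b (i + 1) B = x1 at *
  generalize rowWeight n q b (i + 1) A = x2 at *
  generalize rowWeight n q (b * q) i A = x3 at *
  generalize rowWeight n q (b * q) (i + 1) B = x4 at *
  generalize rowWeight n q (b * q * q) i A = x5 at *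
  generalize rowWeight n q (b * q * q) i B = x6 at *
  have t1 : x3 * x4 * x5⁻¹ * (1 - b * q ^ (n + i + 2 - A)) = x1 * (1 - b * q ^ (n + i + 2 - B)) := by
    field_simp
    linear_combination x4 * s2 - x5 * s1
  have t2 : x3 * x4 * x6⁻¹ * (1 - q ^ (n + i + 1 - B)) = x2 * (1 - q ^ (n + i + 1 - A)) := by
    field_simp
    linear_combination x3 * s4 - x6 * s3
  have hbq : b * q ≠ 0 := mul_ne_zero hb0 hq0
  rw [mul_inv, mul_inv]
  have p1 : (b * q) ^ A * ((b * q) ^ A)⁻¹ = 1 := mul_inv_cancel₀ (pow_ne_zero _ hbq)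
  have p2 : (b * q) ^ B * ((b * q) ^ B)⁻¹ = 1 := mul_inv_cancel₀ (pow_ne_zero _ hbq)
  linear_combination -(b * q) ^ B * t1 + (b * q) ^ (A + 1) * t2
    - (b * q) ^ B * x3 * x4 * x5⁻¹ * (1 - b * q ^ (n + i + 2 - A)) * p1
    + (b * q) ^ (A + 1) * x3 * x4 * x6⁻¹ * (1 - q ^ (n + i + 1 - B)) * p2

end Rows

section Sequences

open Classical in
/-- Sequences `f` with `f i ∈ s i` for `i < M` and `f i = 0` for `M ≤ i`. -/
def seqs (s : ℕ → Finset ℕ) (M : ℕ) : Finset (ℕ → ℕ) :=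
  (Fintype.piFinset fun i : Fin M => s i).image fun f i => if h : i < M then f ⟨i, h⟩ else 0

lemma mem_seqs {s : ℕ → Finset ℕ} {M : ℕ} {f : ℕ → ℕ} :
    f ∈ seqs s M ↔ (∀ i < M, f i ∈ s i) ∧ ∀ i, M ≤ i → f i = 0 := by
  simp only [seqs, mem_image, Fintype.mem_piFinset]
  constructor
  · rintro ⟨g, hg, rfl⟩
    refine ⟨fun i hi => ?_, fun i hi => ?_⟩
    · simpa [hi] using hg ⟨i, hi⟩
    · simp [not_lt.2 hi]
  · rintro ⟨h1, h2⟩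
    refine ⟨fun i => f i, fun i => h1 i i.2, funext fun i => ?_⟩
    by_cases hi : i < M
    · simp [hi]
    · simp [hi, h2 i (not_lt.1 hi)]

lemma sum_seqs {K : Type*} [CommRing K] (s : ℕ → Finset ℕ) (M : ℕ) (g : ℕ → ℕ → K) :
    ∑ f ∈ seqs s M, ∏ i ∈ range M, g i (f i) = ∏ i ∈ range M, ∑ x ∈ s i, g i x := by
  classical
  rw [seqs, sum_image]
  · rw [prod_range, prod_univ_sum]
    refine sum_congr rfl fun f _ => ?_
    rw [prod_range]
    simp
  · intro f _ g _ h
    funext i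
    simpa using congrFun h i

/-- Sequences of length at most `M` with entries at most `n`. -/
def boxSeqs (n M : ℕ) : Finset (ℕ → ℕ) := seqs (fun _ => Icc 0 n) M

lemma mem_boxSeqs {n M : ℕ} {f : ℕ → ℕ} :
    f ∈ boxSeqs n M ↔ (∀ i, f i ≤ n) ∧ ∀ i, M ≤ i → f i = 0 := by
  rw [boxSeqs, mem_seqs]
  refine and_congr_left fun h => ⟨fun h1 i => ?_, fun h1 i _ => by simpa using h1 i⟩
  rcases lt_or_ge i M with hi | hi
  · simpa using h1 i hi
  · simp [h i hi]

/-- `Interlace lam mu` says `lam 0 ≥ mu 0 ≥ lam 1 ≥ mu 1 ≥ ⋯`. -/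
def Interlace (lam mu : ℕ → ℕ) : Prop := ∀ i, lam (i + 1) ≤ mu i ∧ mu i ≤ lam i

lemma Interlace.vanish_below {lam mu : ℕ → ℕ} (h : Interlace lam mu) {c : ℕ}
    (hm : ∀ i, c ≤ i → mu i = 0) : ∀ i, c + 1 ≤ i → lam i = 0 := by
  intro i hi
  obtain ⟨k, rfl⟩ : ∃ k, i = k + 1 := ⟨i - 1, by omega⟩
  have h1 := (h k).1
  rw [hm k (by omega)] at h1
  omega

open Classical in
lemma filter_interlace_above {n m : ℕ} {mu nu : ℕ → ℕ} (hmu : mu ∈ boxSeqs n m)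
    (hnu : nu ∈ boxSeqs n m) :
    {lam ∈ boxSeqs n (m + 1) | Interlace lam mu ∧ Interlace lam nu} =
      seqs (fun i => Icc (max (mu i) (nu i)) (Nat.casesOn i n fun j => min (mu j) (nu j)))
        (m + 1) := by
  rw [mem_boxSeqs] at hmu hnu
  ext lam
  rw [mem_filter, mem_boxSeqs, mem_seqs]
  constructor
  · rintro ⟨⟨h1, h2⟩, h3, h4⟩
    refine ⟨fun i _ => ?_, h2⟩
    rw [mem_Icc]
    refine ⟨max_le (h3 i).2 (h4 i).2, ?_⟩
    cases i with
    | zero => exact h1 0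
    | succ j => exact le_min (h3 j).1 (h4 j).1
  · rintro ⟨h1, h2⟩
    have lower : ∀ i, mu i ≤ lam i ∧ nu i ≤ lam i := fun i => by
      rcases lt_or_ge i (m + 1) with hi | hi
      · exact max_le_iff.1 (mem_Icc.1 (h1 i hi)).1
      · simp [hmu.2 i (by omega), hnu.2 i (by omega)]
    have upper : ∀ i, lam (i + 1) ≤ mu i ∧ lam (i + 1) ≤ nu i := fun i => by
      rcases lt_or_ge (i + 1) (m + 1) with hi | hi
      · exact le_min_iff.1 (mem_Icc.1 (h1 (i + 1) hi)).2
      · simp [h2 (i + 1) hi]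
    refine ⟨⟨fun i => ?_, h2⟩, fun i => ⟨(upper i).1, (lower i).1⟩,
      fun i => ⟨(upper i).2, (lower i).2⟩⟩
    cases i with
    | zero => exact (mem_Icc.1 (h1 0 (by omega))).2
    | succ j => exact (upper j).1.trans (hmu.1 j)

open Classical in
lemma filter_interlace_below {n M : ℕ} {mu nu : ℕ → ℕ} (hmu : mu ∈ boxSeqs n M)
    (hnu : nu ∈ boxSeqs n M) :
    {kap ∈ boxSeqs n M | Interlace mu kap ∧ Interlace nu kap} =
      seqs (fun i => Icc (max (mu (i + 1)) (nu (i + 1))) (min (mu i) (nu i))) M := by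
  rw [mem_boxSeqs] at hmu hnu
  ext kap
  rw [mem_filter, mem_boxSeqs, mem_seqs]
  constructor
  · rintro ⟨⟨h1, h2⟩, h3, h4⟩
    refine ⟨fun i _ => ?_, h2⟩
    exact mem_Icc.2 ⟨max_le (h3 i).1 (h4 i).1, le_min (h3 i).2 (h4 i).2⟩
  · rintro ⟨h1, h2⟩
    have bounds : ∀ i, max (mu (i + 1)) (nu (i + 1)) ≤ kap i ∧ kap i ≤ min (mu i) (nu i) :=
      fun i => by
      rcases lt_or_ge i M with hi | hi
      · exact mem_Icc.1 (h1 i hi)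
      · simp [hmu.2 (i + 1) (by omega), hnu.2 (i + 1) (by omega), h2 i hi]
    simp only [max_le_iff, le_min_iff] at bounds
    exact ⟨⟨fun i => (bounds i).2.1.trans (hmu.1 i), h2⟩,
      fun i => ⟨(bounds i).1.1, (bounds i).2.1⟩, fun i => ⟨(bounds i).1.2, (bounds i).2.2⟩⟩

end Sequences

section LocalMove
variable {K : Type*} [Field K]

/-- The weight `x ^ |λ| ∏ (row weights)` of a partition with at most `M` rows. -/
def seqWeight (n : ℕ) (q b x : K) (M : ℕ) (lam : ℕ → ℕ) : K :=
  ∏ i ∈ range M, x ^ lam i * rowWeight n q b i (lam i)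

variable {n : ℕ} {q b : K}

open Classical in
/-- Summing over a diagonal slice with fixed neighbours `mu` and `nu` above and below it is, up to
a change of weights, the same as summing over the slice on the other side of `mu` and `nu`. -/
lemma local_move (hq0 : q ≠ 0) (hb0 : b ≠ 0)
    (hq : ∀ m, 1 - q ^ (m + 1) ≠ 0) (hb : ∀ m, 1 - b * q ^ (m + 1) ≠ 0) {m : ℕ}
    {mu nu : ℕ → ℕ} (hmu : mu ∈ boxSeqs n m) (hnu : nu ∈ boxSeqs n m) :
    ∑ lam ∈ boxSeqs n (m + 1) with Interlace lam mu ∧ Interlace lam nu,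
        seqWeight n q b (b * q) (m + 1) lam =
      (1 - b * q ^ (n + 1)) / (1 - b * q) * seqWeight n q (b * q) (b * q) (m + 1) mu *
        seqWeight n q (b * q) (b * q) (m + 1) nu *
        ∑ kap ∈ boxSeqs n (m + 1) with Interlace mu kap ∧ Interlace nu kap,
          (seqWeight n q (b * q * q) (b * q) (m + 1) kap)⁻¹ := by
  have widen : ∀ {f}, f ∈ boxSeqs n m → f ∈ boxSeqs n (m + 1) := fun h => by
    rw [mem_boxSeqs] at h ⊢
    exact ⟨h.1, fun i hi => h.2 i (by omega)⟩
  rw [filter_interlace_above hmu hnu, filter_interlace_below (widen hmu) (widen hnu)]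
  rw [mem_boxSeqs] at hmu hnu
  simp only [seqWeight, ← prod_inv_distrib]
  rw [sum_seqs _ _ fun i x => (b * q) ^ x * rowWeight n q b i x,
    sum_seqs _ _ fun i x => ((b * q) ^ x * rowWeight n q (b * q * q) i x)⁻¹]
  have pair : (∏ i ∈ range (m + 1), (b * q) ^ mu i * rowWeight n q (b * q) i (mu i)) *
      (∏ i ∈ range (m + 1), (b * q) ^ nu i * rowWeight n q (b * q) i (nu i)) =
      (∏ i ∈ range m, (b * q) ^ min (mu i) (nu i) * rowWeight n q (b * q) i (min (mu i) (nu i))) *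
      ∏ i ∈ range (m + 1),
        (b * q) ^ max (mu i) (nu i) * rowWeight n q (b * q) i (max (mu i) (nu i)) := by
    have last : (b * q) ^ min (mu m) (nu m) *
        rowWeight n q (b * q) m (min (mu m) (nu m)) = 1 := by
      simp [hmu.2 m le_rfl, rowWeight_zero]
    rw [← mul_one (∏ i ∈ range m, _), ← last, ← prod_range_succ
      (fun i => (b * q) ^ min (mu i) (nu i) * rowWeight n q (b * q) i (min (mu i) (nu i))),
      ← prod_mul_distrib, ← prod_mul_distrib]
    refine prod_congr rfl fun i _ => ?_
    rcases le_total (mu i) (nu i) with h | h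
    · rw [min_eq_left h, max_eq_right h]
    · rw [min_eq_right h, max_eq_left h, mul_comm]
  rw [mul_assoc ((1 - b * q ^ (n + 1)) / (1 - b * q)), pair, prod_range_succ', prod_range_succ',
    prod_range_succ (fun i => ∑ x ∈ Icc (max (mu (i + 1)) (nu (i + 1))) (min (mu i) (nu i)), _)]
  have lastSum : ∑ x ∈ Icc (max (mu (m + 1)) (nu (m + 1))) (min (mu m) (nu m)),
      ((b * q) ^ x * rowWeight n q (b * q * q) m x)⁻¹ = 1 := by
    simp [hmu.2 m le_rfl, hmu.2 (m + 1) (by omega), hnu.2 (m + 1) (by omega), rowWeight_zero]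
  have first := sum_rowWeight_first (n := n) hb (max_le (hmu.1 0) (hnu.1 0))
  have rest : ∀ i ∈ range m, _ := fun i _ => sum_rowWeight_succ hq0 hb0 hq hb i
    (B := max (mu (i + 1)) (nu (i + 1))) ((min_le_left (mu i) (nu i)).trans (hmu.1 i))
  rw [lastSum, prod_congr rfl rest, prod_mul_distrib, prod_mul_distrib]
  refine Eq.trans (congrArg _ first) ?_
  ring

end LocalMove

section Slices
variable {K : Type*} [Field K]

/-- The product `q ^ |λ|` over the first `M` rows. -/
def sizePow (q : K) (M : ℕ) (lam : ℕ → ℕ) : K := ∏ i ∈ range M, q ^ lam i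

open Classical in
/-- The generating function of the chains of `c` successively interlacing sequences that start
below `nu` and end with the zero sequence. -/
def halfSum (n M : ℕ) (q : K) : ℕ → (ℕ → ℕ) → K
  | 0, nu => if nu = 0 then 1 else 0
  | c + 1, nu => ∑ kap ∈ boxSeqs n M with Interlace nu kap, sizePow q M kap * halfSum n M q c kap

/-- The factor by which one step of the recursion on the number of rows changes the sum. -/
def sliceFactor (n : ℕ) (q b : K) (c : ℕ) : K :=
  ∏ j ∈ range c, (1 - b * q ^ (n + 1 + j)) / (1 - b * q ^ (1 + j))

variable {n : ℕ} {q b : K}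

lemma sliceFactor_succ (c : ℕ) : sliceFactor n q b (c + 1) =
    (1 - b * q ^ (n + 1)) / (1 - b * q) * sliceFactor n q (b * q) c := by
  rw [sliceFactor, prod_range_succ', mul_comm, sliceFactor]
  congr 1
  · simp
  · refine prod_congr rfl fun j _ => ?_
    congr 2 <;> ring

lemma sizePow_mul_seqWeight (x : K) (M : ℕ) (lam : ℕ → ℕ) :
    sizePow q M lam * seqWeight n q b x M lam = seqWeight n q b (x * q) M lam := by
  rw [sizePow, seqWeight, seqWeight, ← prod_mul_distrib]
  exact prod_congr rfl fun i _ => by ring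

lemma seqWeight_ne_zero (hq : ∀ m, 1 - q ^ (m + 1) ≠ 0) (hb : ∀ m, 1 - b * q ^ (m + 1) ≠ 0)
    {x : K} (hx : x ≠ 0) {M : ℕ} {lam : ℕ → ℕ} (hl : ∀ i, lam i ≤ n) :
    seqWeight n q b x M lam ≠ 0 :=
  prod_ne_zero_iff.2 fun i _ => mul_ne_zero (pow_ne_zero _ hx) (rowWeight_ne_zero hq hb i (hl i))

lemma seqWeight_zero (x : K) (M : ℕ) : seqWeight n q b x M 0 = 1 := by
  simp [seqWeight, rowWeight_zero]

lemma halfSum_vanish {M c : ℕ} {nu : ℕ → ℕ} (h : halfSum n M q c nu ≠ 0) :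
    ∀ i, c ≤ i → nu i = 0 := by
  classical
  induction c generalizing nu with
  | zero =>
    rw [halfSum] at h
    simp only [ne_eq, ite_eq_right_iff, one_ne_zero, imp_false, not_not] at h
    simp [h]
  | succ c ih =>
    rw [halfSum] at h
    obtain ⟨kap, hk, hk'⟩ := exists_ne_zero_of_sum_ne_zero h
    exact (mem_filter.1 hk).2.vanish_below (ih (right_ne_zero_of_mul hk'))

lemma mem_boxSeqs_of_halfSum_ne_zero {M m c : ℕ} {nu : ℕ → ℕ} (hnu : nu ∈ boxSeqs n M)
    (h : halfSum n M q c nu ≠ 0) (hc : c ≤ m) : nu ∈ boxSeqs n m :=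
  mem_boxSeqs.2 ⟨(mem_boxSeqs.1 hnu).1, fun i hi => halfSum_vanish h i (hc.trans hi)⟩

lemma zero_mem_boxSeqs (n M : ℕ) : (0 : ℕ → ℕ) ∈ boxSeqs n M := by
  simp [mem_boxSeqs]

lemma interlace_zero_iff {kap : ℕ → ℕ} : Interlace 0 kap ↔ kap = 0 := by
  constructor
  · intro h
    funext i
    simpa using (h i).2
  · rintro rfl i
    simp

lemma halfSum_zero_seq (M c : ℕ) : halfSum n M q c 0 = 1 := by
  classical
  induction c with
  | zero => simp [halfSum]
  | succ c ih =>
    rw [halfSum, sum_eq_single 0]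
    · simp [sizePow, ih]
    · intro kap hk hk0
      exact absurd (interlace_zero_iff.1 (mem_filter.1 hk).2) hk0
    · intro h
      exact absurd (mem_filter.2 ⟨zero_mem_boxSeqs n M, interlace_zero_iff.2 rfl⟩) h

open Classical in
/-- Removing the slice next to the central diagonal. -/
lemma sum_slice (hq0 : q ≠ 0) (hq : ∀ m, 1 - q ^ (m + 1) ≠ 0) {m c : ℕ} (hc : c ≤ m) :
    ∀ {b : K} (_ : b ≠ 0) (_ : ∀ m, 1 - b * q ^ (m + 1) ≠ 0) {mu : ℕ → ℕ} (_ : mu ∈ boxSeqs n m),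
    ∑ lam ∈ boxSeqs n (m + 1) with Interlace lam mu,
        seqWeight n q b (b * q) (m + 1) lam * halfSum n (m + 1) q c lam =
      sliceFactor n q b c * seqWeight n q (b * q) (b * q) (m + 1) mu *
        halfSum n (m + 1) q c mu := by
  induction c with
  | zero =>
    intro b hb0 hb mu hmu
    simp only [halfSum, mul_ite, mul_one, mul_zero, sum_ite_eq', mem_filter, zero_mem_boxSeqs,
      true_and, interlace_zero_iff, seqWeight_zero]
    split_ifs with h
    · simp [h, seqWeight_zero, sliceFactor]
    · rfl
  | succ c ih =>
    intro b hb0 hb mu hmu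
    have hb1 := one_sub_shift_ne hb
    have hb2 := one_sub_shift_ne hb1
    have hbq : b * q ≠ 0 := mul_ne_zero hb0 hq0
    set M := m + 1 with hM
    calc
      _ = ∑ nu ∈ boxSeqs n M, sizePow q M nu * halfSum n M q c nu *
            ∑ lam ∈ boxSeqs n M with Interlace lam mu ∧ Interlace lam nu,
              seqWeight n q b (b * q) M lam := by
        simp only [halfSum, mul_sum, sum_filter]
        symm
        rw [sum_comm]
        refine sum_congr rfl fun lam _ => ?_
        by_cases h1 : Interlace lam mu
        · simp only [h1, true_and, if_true]
          refine sum_congr rfl fun nu _ => ?_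
          by_cases h2 : Interlace lam nu <;> simp [h2]
          ring
        · simp [h1]
      _ = ∑ nu ∈ boxSeqs n M, sizePow q M nu * halfSum n M q c nu *
            ((1 - b * q ^ (n + 1)) / (1 - b * q) * seqWeight n q (b * q) (b * q) M mu *
              seqWeight n q (b * q) (b * q) M nu *
              ∑ kap ∈ boxSeqs n M with Interlace mu kap ∧ Interlace nu kap,
                (seqWeight n q (b * q * q) (b * q) M kap)⁻¹) := by
        refine sum_congr rfl fun nu hnu => ?_
        by_cases h : halfSum n M q c nu = 0
        · simp [h]
        · rw [local_move hq0 hb0 hq hb hmu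
            (mem_boxSeqs_of_halfSum_ne_zero hnu h (by omega))]
      _ = (1 - b * q ^ (n + 1)) / (1 - b * q) * seqWeight n q (b * q) (b * q) M mu *
            ∑ kap ∈ boxSeqs n M with Interlace mu kap,
              (seqWeight n q (b * q * q) (b * q) M kap)⁻¹ *
                ∑ nu ∈ boxSeqs n M with Interlace nu kap,
                  seqWeight n q (b * q) (b * q * q) M nu * halfSum n M q c nu := by
        simp only [mul_sum, sum_filter, ← sizePow_mul_seqWeight (b * q)]
        rw [sum_comm]
        refine sum_congr rfl fun kap _ => ?_
        by_cases h1 : Interlace mu kap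
        · simp only [h1, true_and, if_true, mul_sum]
          refine sum_congr rfl fun nu _ => ?_
          by_cases h2 : Interlace nu kap <;> simp [h2]
          ring
        · simp [h1]
      _ = (1 - b * q ^ (n + 1)) / (1 - b * q) * seqWeight n q (b * q) (b * q) M mu *
            ∑ kap ∈ boxSeqs n M with Interlace mu kap,
              sliceFactor n q (b * q) c * (sizePow q M kap * halfSum n M q c kap) := by
        congr 1
        refine sum_congr rfl fun kap hkap => ?_
        obtain ⟨hk, hint⟩ := mem_filter.1 hkap
        have hk' : kap ∈ boxSeqs n m := mem_boxSeqs.2 ⟨(mem_boxSeqs.1 hk).1, fun i hi =>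
          Nat.le_zero.1 ((hint i).2.trans ((mem_boxSeqs.1 hmu).2 i hi).le)⟩
        rw [ih (by omega) hbq hb1 hk', ← sizePow_mul_seqWeight (b * q)]
        have hw := seqWeight_ne_zero hq hb2 hbq (M := M) (mem_boxSeqs.1 hk).1
        linear_combination (sliceFactor n q (b * q) c * sizePow q M kap * halfSum n M q c kap) *
          inv_mul_cancel₀ hw
      _ = _ := by
        rw [← mul_sum, sliceFactor_succ, halfSum]
        ring

/-- The weighted sum over the central diagonal slice. -/
lemma sum_central (hq0 : q ≠ 0) (hq : ∀ m, 1 - q ^ (m + 1) ≠ 0) {m c r : ℕ} (hc : c ≤ m)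
    (hr : r ≤ m) : ∀ {b : K} (_ : b ≠ 0) (_ : ∀ m, 1 - b * q ^ (m + 1) ≠ 0),
    ∑ lam ∈ boxSeqs n (m + 1), seqWeight n q b (b * q) (m + 1) lam *
        halfSum n (m + 1) q c lam * halfSum n (m + 1) q r lam =
      ∏ i ∈ range r, sliceFactor n q (b * q ^ i) c := by
  classical
  induction r with
  | zero =>
    intro b hb0 hb
    simp [halfSum, zero_mem_boxSeqs, seqWeight_zero, halfSum_zero_seq]
  | succ r ih =>
    intro b hb0 hb
    set M := m + 1 with hM
    calc
      _ = ∑ mu ∈ boxSeqs n M, sizePow q M mu * halfSum n M q r mu *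
            ∑ lam ∈ boxSeqs n M with Interlace lam mu,
              seqWeight n q b (b * q) M lam * halfSum n M q c lam := by
        rw [sum_congr rfl fun lam _ => by rw [halfSum]]
        simp only [mul_sum, sum_filter]
        rw [sum_comm]
        refine sum_congr rfl fun mu _ => sum_congr rfl fun lam _ => ?_
        by_cases h : Interlace lam mu <;> simp [h]
        ring
      _ = ∑ mu ∈ boxSeqs n M, sliceFactor n q b c *
            (seqWeight n q (b * q) (b * q * q) M mu * halfSum n M q c mu *
              halfSum n M q r mu) := by
        refine sum_congr rfl fun mu hmu => ?_
        by_cases h : halfSum n M q r mu = 0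
        · simp [h]
        · rw [sum_slice hq0 hq hc hb0 hb (mem_boxSeqs_of_halfSum_ne_zero hmu h (by omega)),
            ← sizePow_mul_seqWeight (b * q)]
          ring
      _ = _ := by
        rw [← mul_sum, ih (by omega) (mul_ne_zero hb0 hq0) (one_sub_shift_ne hb),
          prod_range_succ', mul_comm, pow_zero, mul_one]
        congr 1
        exact prod_congr rfl fun i _ => by rw [pow_succ', mul_assoc]

end Slices

section Chains

open Classical in
/-- Chains of interlacing sequences `lam = d 0, d 1, …` with `d t = 0` for `r ≤ t`. -/
def chains (n M : ℕ) : ℕ → (ℕ → ℕ) → Finset (ℕ → ℕ → ℕ)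
  | 0, lam => if lam = 0 then {0} else ∅
  | r + 1, lam => {kap ∈ boxSeqs n M | Interlace lam kap}.biUnion fun kap =>
      (chains n M r kap).image fun d t => Nat.casesOn t lam d

variable {n M : ℕ}

lemma mem_chains {r : ℕ} {lam : ℕ → ℕ} {d : ℕ → ℕ → ℕ} :
    d ∈ chains n M r lam ↔ d 0 = lam ∧ (∀ t, Interlace (d t) (d (t + 1))) ∧
      (∀ t, d (t + 1) ∈ boxSeqs n M) ∧ ∀ t, r ≤ t → d t = 0 := by
  classical
  induction r generalizing lam d with
  | zero =>
    rw [chains]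
    constructor
    · intro h
      split_ifs at h with hl
      · rw [mem_singleton] at h
        subst h hl
        exact ⟨rfl, fun t => interlace_zero_iff.2 rfl, fun t => zero_mem_boxSeqs n M,
          fun _ _ => rfl⟩
      · simp at h
    · rintro ⟨h1, -, -, h4⟩
      have hd : d = 0 := funext fun t => h4 t (Nat.zero_le t)
      rw [if_pos (by rw [← h1, hd]; rfl), hd, mem_singleton]
  | succ r ih =>
    simp only [chains, mem_biUnion, mem_filter, mem_image]
    constructor
    · rintro ⟨kap, ⟨hk, hlk⟩, e, he, rfl⟩
      obtain ⟨h1, h2, h3, h4⟩ := ih.1 he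
      refine ⟨rfl, fun t => ?_, fun t => ?_, fun t ht => ?_⟩
      · cases t with
        | zero => subst h1; exact hlk
        | succ t => exact h2 t
      · cases t with
        | zero => subst h1; exact hk
        | succ t => exact h3 t
      · cases t with
        | zero => omega
        | succ t => exact h4 t (by omega)
    · rintro ⟨rfl, h2, h3, h4⟩
      refine ⟨d 1, ⟨h3 0, h2 0⟩, fun t => d (t + 1), ih.2 ⟨rfl, fun t => h2 (t + 1),
        fun t => h3 (t + 1), fun t ht => h4 (t + 1) (by omega)⟩, funext fun t => ?_⟩
      cases t <;> rfl

lemma halfSum_eq_sum_chains {K : Type*} [Field K] (q : K) {r T : ℕ} (hT : r ≤ T)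
    (lam : ℕ → ℕ) :
    halfSum n M q r lam =
      ∑ d ∈ chains n M r lam, ∏ t ∈ range T, sizePow q M (d (t + 1)) := by
  classical
  induction r generalizing lam T with
  | zero =>
    rw [halfSum, chains]
    split_ifs
    · simp [sizePow]
    · simp
  | succ r ih =>
    obtain ⟨T, rfl⟩ : ∃ S, T = S + 1 := ⟨T - 1, by omega⟩
    rw [halfSum, chains, sum_biUnion]
    · refine sum_congr rfl fun kap _ => ?_
      rw [sum_image, ih (T := T) (by omega), mul_sum]
      · refine sum_congr rfl fun d hd => ?_
        rw [prod_range_succ', mul_comm, ← (mem_chains.1 hd).1]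
      · intro d _ e _ h
        funext t
        exact congrFun h (t + 1)
    · intro k1 _ k2 _ hne
      refine disjoint_left.2 fun d h1 h2 => hne ?_
      obtain ⟨e1, he1, rfl⟩ := mem_image.1 h1
      obtain ⟨e2, he2, h⟩ := mem_image.1 h2
      rw [← (mem_chains.1 he1).1, ← (mem_chains.1 he2).1]
      exact (congrFun h 1).symm

lemma chain_antitone {d : ℕ → ℕ → ℕ} (h : ∀ t, Interlace (d t) (d (t + 1))) (t s : ℕ) :
    d t s ≤ d (t + s) 0 := by
  induction s generalizing t with
  | zero => rfl
  | succ s ih =>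
    refine ((h t s).1.trans (ih (t + 1))).trans_eq ?_
    rw [show t + 1 + s = t + (s + 1) by ring]

lemma chain_le_head {d : ℕ → ℕ → ℕ} (h : ∀ t, Interlace (d t) (d (t + 1))) (t s : ℕ) :
    d t s ≤ d 0 s := by
  induction t with
  | zero => rfl
  | succ t ih => exact (h t s).2.trans ih

end Chains

section Diagonals

lemma sum_range_ite_lt {M : ℕ} (g : ℕ → ℕ) (hg : ∀ i, M ≤ i → g i = 0) (s : ℕ) :
    ∑ i ∈ range M, (if s < i then g i else 0) = ∑ t ∈ range M, g (s + t + 1) := by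
  have h : ∑ t ∈ range M, g (s + t + 1) = ∑ i ∈ Ico (s + 1) (s + 1 + M), g i := by
    rw [sum_Ico_eq_sum_range, Nat.add_sub_cancel_left]
    exact sum_congr rfl fun t _ => by rw [add_right_comm]
  rw [h, ← sum_filter]
  refine sum_subset (fun i hi => ?_) fun i hi hi' => hg i ?_
  · simp only [mem_filter, mem_range] at hi
    simp only [mem_Ico]
    omega
  · simp only [mem_filter, mem_range, mem_Ico] at hi hi'
    omega

lemma sum_square_eq_sum_diagonals {M : ℕ} (f : ℕ → ℕ → ℕ)
    (hf : ∀ i j, M ≤ i ∨ M ≤ j → f i j = 0) :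
    ∑ i ∈ range M, ∑ j ∈ range M, f i j =
      ∑ s ∈ range M, f s s + ∑ t ∈ range M, ∑ s ∈ range M, f (s + t + 1) s +
        ∑ t ∈ range M, ∑ s ∈ range M, f s (s + t + 1) := by
  have split : ∀ i j, f i j = (if j = i then f i j else 0) + (if j < i then f i j else 0) +
      (if i < j then f i j else 0) := fun i j => by
    rcases lt_trichotomy i j with h | h | h
    · simp [h, h.ne', h.not_gt]
    · simp [h]
    · simp [h, h.ne, h.not_gt]
  rw [sum_congr rfl fun i _ => sum_congr rfl fun j _ => split i j]
  simp only [sum_add_distrib]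
  congr 1
  · congr 1
    · refine sum_congr rfl fun i hi => ?_
      rw [sum_ite_eq', if_pos hi]
    · rw [sum_comm, sum_comm (s := range M) (f := fun t s => f (s + t + 1) s)]
      exact sum_congr rfl fun s _ => sum_range_ite_lt (fun i => f i s) (fun i hi => hf i s (.inl hi)) s
  · rw [sum_comm (s := range M) (f := fun t s => f s (s + t + 1))]
    exact sum_congr rfl fun s _ => sum_range_ite_lt (f s) (fun i hi => hf s i (.inr hi)) s

end Diagonals

section PlanePartitions
variable {r c n M : ℕ} {p : ℕ → ℕ → ℕ}

lemma IsPlanePartition.diag_antitone (hp : IsPlanePartition r c p) :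
    Antitone fun s => p (s + 1) (s + 1) :=
  antitone_nat_of_succ_le fun s =>
    (hp.1 (s + 1 + 1) (s + 1) (by omega) (by omega)).trans
      (hp.2.1 (s + 1) (s + 1) (by omega) (by omega))

lemma IsPlanePartition.lt_durfee_iff (hp : IsPlanePartition r c p) (m k : ℕ) :
    m < durfee p (k + 1) ↔ k < p (m + 1) (m + 1) := by
  have bdd : BddAbove {s | k + 1 ≤ p s s} := by
    refine ⟨r, fun s hs => ?_⟩
    by_contra h
    rw [Set.mem_ofPred_eq, hp.2.2.1 s s (.inl (by omega))] at hs
    omega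
  constructor
  · intro h
    have hne : {s | k + 1 ≤ p s s}.Nonempty := by
      by_contra hne
      rw [durfee, Set.not_nonempty_iff_eq_empty.1 hne] at h
      simp at h
    have hmem : k + 1 ≤ p (durfee p (k + 1)) (durfee p (k + 1)) := Nat.sSup_mem hne bdd
    obtain ⟨s, hs⟩ : ∃ s, durfee p (k + 1) = s + 1 := ⟨durfee p (k + 1) - 1, by omega⟩
    rw [hs] at hmem h
    exact hmem.trans (hp.diag_antitone (by omega))
  · intro h
    exact le_csSup bdd (show k + 1 ≤ p (m + 1) (m + 1) from h)

lemma prod_Icc_one_eq_prod_range {K : Type*} [CommMonoid K] (N : ℕ) (f : ℕ → K) :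
    ∏ i ∈ Icc 1 N, f i = ∏ i ∈ range N, f (i + 1) := by
  rw [range_eq_Ico, prod_Ico_add' f 0 N 1]
  rfl

lemma prod_durfee_eq {K : Type*} [Field K] (a q : K) (hp : p ∈ boxPP r c n) (hM : r ≤ M) :
    ∏ k ∈ Icc 1 (p 1 1), poch (q ^ (n - k + 1)) q (durfee p k) /
        poch (a * q ^ (n - k + 1)) q (durfee p k) =
      ∏ i ∈ range M, rowWeight n q a i (p (i + 1) (i + 1)) := by
  obtain ⟨hpp, hn⟩ := hp
  rw [prod_Icc_one_eq_prod_range]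
  simp only [poch, ← prod_div_distrib, rowWeight]
  rw [prod_comm' (t' := range M) (s' := fun i => range (p (i + 1) (i + 1)))]
  · refine prod_congr rfl fun i _ => prod_congr rfl fun j hj => ?_
    have hjn : j < n := (mem_range.1 hj).trans_le (hn _ _)
    rw [mul_assoc, ← pow_add, show n - (j + 1) + 1 + i = n + i - j by omega]
  · intro j i
    simp only [mem_range, hpp.lt_durfee_iff]
    constructor
    · rintro ⟨-, h⟩
      refine ⟨h, ?_⟩
      by_contra hi
      rw [hpp.2.2.1 (i + 1) (i + 1) (.inl (by omega))] at h
      omega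
    · rintro ⟨h, -⟩
      exact ⟨h.trans_le (hpp.diag_antitone (Nat.zero_le i)), h⟩

lemma ppTrace_eq (hp : IsPlanePartition r c p) (hM : r ≤ M) :
    ppTrace p = ∑ s ∈ range M, p (s + 1) (s + 1) := by
  rw [ppTrace, finsum_eq_sum_of_support_subset (s := range (M + 1)), sum_range_succ',
    hp.2.2.2 0 0 (.inl rfl), add_zero]
  intro i hi
  by_contra h
  simp only [coe_range, Set.mem_Iio, not_lt] at h
  exact hi (hp.2.2.1 i i (.inl (by omega)))

lemma ppNorm_eq (hp : IsPlanePartition r c p) (hr : r ≤ M) (hc : c ≤ M) :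
    ppNorm p = ∑ s ∈ range M, p (s + 1) (s + 1) +
      ∑ t ∈ range M, ∑ s ∈ range M, p (s + 1 + (t + 1)) (s + 1) +
      ∑ t ∈ range M, ∑ s ∈ range M, p (s + 1) (s + 1 + (t + 1)) := by
  have row : ∀ i, ∑ᶠ j, p i j = ∑ j ∈ range M, p i (j + 1) := fun i => by
    rw [finsum_eq_sum_of_support_subset (s := range (M + 1)), sum_range_succ',
      hp.2.2.2 i 0 (.inr rfl), add_zero]
    intro j hj
    by_contra h
    simp only [coe_range, Set.mem_Iio, not_lt] at h
    exact hj (hp.2.2.1 i j (.inr (by omega)))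
  have total : ppNorm p = ∑ i ∈ range M, ∑ j ∈ range M, p (i + 1) (j + 1) := by
    simp only [ppNorm, row]
    rw [finsum_eq_sum_of_support_subset (s := range (M + 1)), sum_range_succ',
      sum_eq_zero fun j _ => hp.2.2.2 0 (j + 1) (.inl rfl), add_zero]
    intro i hi
    by_contra h
    simp only [coe_range, Set.mem_Iio, not_lt] at h
    exact hi (sum_eq_zero fun j _ => hp.2.2.1 i (j + 1) (.inl (by omega)))
  rw [total, sum_square_eq_sum_diagonals (fun i j => p (i + 1) (j + 1)) fun i j h =>
    hp.2.2.1 (i + 1) (j + 1) (by omega)]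
  have shift : ∀ s t, s + t + 1 + 1 = s + 1 + (t + 1) := fun s t => by ring
  simp only [shift]

/-- The central diagonal of a plane partition together with the slices below and above it. -/
def slices (p : ℕ → ℕ → ℕ) : Σ _ : ℕ → ℕ, (ℕ → ℕ → ℕ) × (ℕ → ℕ → ℕ) :=
  ⟨fun s => p (s + 1) (s + 1), fun t s => p (s + 1 + t) (s + 1), fun t s => p (s + 1) (s + 1 + t)⟩

/-- The plane partition with given slices below and above its central diagonal. -/
def glue (d e : ℕ → ℕ → ℕ) (i j : ℕ) : ℕ :=
  if i = 0 ∨ j = 0 then 0 else if j ≤ i then d (i - j) (j - 1) else e (j - i) (i - 1)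

lemma slices_injOn : Set.InjOn slices (boxPP r c n) := by
  intro p hp p' hp' h
  simp only [slices, Sigma.mk.injEq, heq_eq_eq, Prod.mk.injEq] at h
  obtain ⟨-, h1, h2⟩ := h
  funext i j
  by_cases h0 : i = 0 ∨ j = 0
  · rw [hp.1.2.2.2 i j h0, hp'.1.2.2.2 i j h0]
  rcases le_total j i with hij | hij
  · have := congrFun (congrFun h1 (i - j)) (j - 1)
    rwa [show j - 1 + 1 + (i - j) = i by omega, show j - 1 + 1 = j by omega] at this
  · have := congrFun (congrFun h2 (j - i)) (i - 1)
    rwa [show i - 1 + 1 + (j - i) = j by omega, show i - 1 + 1 = i by omega] at this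

lemma slices_bijOn (hr : r ≤ M) :
    Set.BijOn slices (boxPP r c n)
      ((boxSeqs n M).sigma fun lam => chains n M r lam ×ˢ chains n M c lam) := by
  refine ⟨fun p hp => ?_, slices_injOn, ?_⟩
  · obtain ⟨⟨hrow, hcol, hzero, -⟩, hn⟩ := hp
    simp only [slices, coe_sigma, Set.mem_sigma_iff, mem_coe, mem_product, mem_chains,
      mem_boxSeqs]
    refine ⟨⟨fun i => hn _ _, fun i hi => hzero _ _ (.inl (by omega))⟩,
      ⟨trivial, fun t s => ⟨?_, ?_⟩, fun t => ⟨fun i => hn _ _, fun i hi => hzero _ _ (.inl (by omega))⟩,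
        fun t ht => funext fun s => hzero _ _ (.inl (by omega))⟩,
      ⟨trivial, fun t s => ⟨?_, ?_⟩, fun t => ⟨fun i => hn _ _, fun i hi => hzero _ _ (.inl (by omega))⟩,
        fun t ht => funext fun s => hzero _ _ (.inr (by omega))⟩⟩
    · change p (s + 1 + 1 + t) (s + 1 + 1) ≤ p (s + 1 + (t + 1)) (s + 1)
      rw [show s + 1 + (t + 1) = s + 1 + 1 + t by ring]
      exact hrow (s + 1 + 1 + t) (s + 1) (by omega) (by omega)
    · exact hcol (s + 1 + t) (s + 1) (by omega) (by omega)
    · change p (s + 1 + 1) (s + 1 + 1 + t) ≤ p (s + 1) (s + 1 + (t + 1))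
      rw [show s + 1 + (t + 1) = s + 1 + 1 + t by ring]
      exact hcol (s + 1) (s + 1 + 1 + t) (by omega) (by omega)
    · exact hrow (s + 1) (s + 1 + t) (by omega) (by omega)
  · rintro ⟨lam, d, e⟩ h
    simp only [coe_sigma, Set.mem_sigma_iff, mem_coe, mem_product, mem_chains] at h
    obtain ⟨hl, ⟨d0, d1, d2, d3⟩, e0, e1, e2, e3⟩ := h
    have dbox : ∀ t, d t ∈ boxSeqs n M := fun t => by
      cases t with
      | zero => rwa [d0]
      | succ t => exact d2 t
    have ebox : ∀ t, e t ∈ boxSeqs n M := fun t => by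
      cases t with
      | zero => rwa [e0]
      | succ t => exact e2 t
    have dvan : ∀ t s, r ≤ t + s → d t s = 0 := fun t s h =>
      Nat.le_zero.1 ((chain_antitone d1 t s).trans (by simp [d3 (t + s) h]))
    have evan : ∀ t s, c ≤ t + s → e t s = 0 := fun t s h =>
      Nat.le_zero.1 ((chain_antitone e1 t s).trans (by simp [e3 (t + s) h]))
    have low : ∀ t s, glue d e (s + 1 + t) (s + 1) = d t s := fun t s => by
      simp [glue]
    have high : ∀ t s, glue d e (s + 1) (s + 1 + t) = e t s := fun t s => by
      cases t with
      | zero => simp [glue, d0, e0]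
      | succ t => simp [glue]
    have cases_index : ∀ i j, 1 ≤ i → 1 ≤ j →
        (∃ t s, i = s + 1 + t ∧ j = s + 1) ∨ ∃ t s, i = s + 1 ∧ j = s + 1 + (t + 1) := by
      intro i j hi hj
      rcases le_or_gt j i with h | h
      · exact .inl ⟨i - j, j - 1, by omega, by omega⟩
      · exact .inr ⟨j - i - 1, i - 1, by omega, by omega⟩
    have outside : ∀ i j, i = 0 ∨ j = 0 → glue d e i j = 0 := fun i j h => by simp [glue, h]
    refine ⟨glue d e, ⟨⟨?_, ?_, ?_, outside⟩, ?_⟩, ?_⟩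
    · intro i j hi hj
      rcases cases_index i j hi hj with ⟨t, s, rfl, rfl⟩ | ⟨t, s, rfl, rfl⟩
      · cases t with
        | zero =>
          have h1 := high 1 s
          have h0 := high 0 s
          simp only [add_zero] at h0 h1 ⊢
          rw [h0, h1]
          exact (e1 0 s).2
        | succ t =>
          rw [low, show s + 1 + (t + 1) = s + 1 + 1 + t by ring, low]
          exact (d1 t s).1
      · rw [high, add_assoc (s + 1) (t + 1) 1, high]
        exact (e1 (t + 1) s).2
    · intro i j hi hj
      rcases cases_index i j hi hj with ⟨t, s, rfl, rfl⟩ | ⟨t, s, rfl, rfl⟩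
      · rw [low, add_assoc (s + 1) t 1, low]
        exact (d1 t s).2
      · rw [high, show s + 1 + (t + 1) = s + 1 + 1 + t by ring, high]
        exact (e1 t s).1
    · intro i j h
      by_cases h0 : i = 0 ∨ j = 0
      · exact outside i j h0
      have dcol : ∀ s, c ≤ s → d 0 s = 0 := fun s hs => by
        rw [d0, ← e0]; exact evan 0 s (by omega)
      have erow : ∀ s, r ≤ s → e 0 s = 0 := fun s hs => by
        rw [e0, ← d0]; exact dvan 0 s (by omega)
      rcases cases_index i j (by omega) (by omega) with ⟨t, s, rfl, rfl⟩ | ⟨t, s, rfl, rfl⟩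
      · rw [low]
        rcases h with h | h
        · exact dvan t s (by omega)
        · exact Nat.le_zero.1 ((chain_le_head d1 t s).trans_eq (dcol s (by omega)))
      · rw [high]
        rcases h with h | h
        · exact Nat.le_zero.1 ((chain_le_head e1 (t + 1) s).trans_eq (erow s (by omega)))
        · exact evan (t + 1) s (by omega)
    · intro i j
      by_cases h0 : i = 0 ∨ j = 0
      · simp [outside i j h0]
      rcases cases_index i j (by omega) (by omega) with ⟨t, s, rfl, rfl⟩ | ⟨t, s, rfl, rfl⟩
      · rw [low]
        exact (mem_boxSeqs.1 (dbox t)).1 s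
      · rw [high]
        exact (mem_boxSeqs.1 (ebox (t + 1))).1 s
    · have hdiag : (fun s => glue d e (s + 1) (s + 1)) = lam := by
        rw [← d0]
        exact funext fun s => low 0 s
      simp only [slices, low, high, hdiag]

end PlanePartitions

lemma one_sub_qv_pow_ne_zero (m : ℕ) : 1 - qv ^ (m + 1) ≠ 0 := by
  intro h
  have h1 : algebraMap (MvPolynomial (Fin 2) ℚ) Kaq (1 - MvPolynomial.X 1 ^ (m + 1)) = 0 := by
    simpa [qv] using h
  rw [FaithfulSMul.algebraMap_eq_zero_iff] at h1
  have h2 := congrArg (MvPolynomial.eval fun _ => (0 : ℚ)) h1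
  simp at h2

lemma one_sub_av_mul_qv_pow_ne_zero (m : ℕ) : 1 - av * qv ^ (m + 1) ≠ 0 := by
  intro h
  have h1 : algebraMap (MvPolynomial (Fin 2) ℚ) Kaq
      (1 - MvPolynomial.X 0 * MvPolynomial.X 1 ^ (m + 1)) = 0 := by
    simpa [qv, av] using h
  rw [FaithfulSMul.algebraMap_eq_zero_iff] at h1
  have h2 := congrArg (MvPolynomial.eval fun _ => (0 : ℚ)) h1
  simp at h2

lemma qv_ne_zero : qv ≠ 0 := by
  rw [qv, ne_eq, FaithfulSMul.algebraMap_eq_zero_iff]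
  exact MvPolynomial.X_ne_zero 1

lemma av_ne_zero : av ≠ 0 := by
  rw [av, ne_eq, FaithfulSMul.algebraMap_eq_zero_iff]
  exact MvPolynomial.X_ne_zero 0

lemma prod_range_sliceFactor {K : Type*} [Field K] {a q : K}
    (ha : ∀ m, 1 - a * q ^ (m + 1) ≠ 0) (r c n : ℕ) :
    ∏ i ∈ range r, sliceFactor n q (a * q ^ i) c =
      ∏ i ∈ Icc 1 r, ∏ j ∈ Icc 1 c, ∏ k ∈ Icc 1 n,
        (1 - a * q ^ (i + j + k - 1)) / (1 - a * q ^ (i + j + k - 2)) := by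
  simp only [prod_Icc_one_eq_prod_range, sliceFactor]
  refine prod_congr rfl fun i _ => prod_congr rfl fun j _ => ?_
  have tele : ∀ N, ∏ k ∈ range N, (1 - a * q ^ (i + 1 + (j + 1) + (k + 1) - 1)) /
      (1 - a * q ^ (i + 1 + (j + 1) + (k + 1) - 2)) =
      (1 - a * q ^ (i + j + N + 1)) / (1 - a * q ^ (i + j + 1)) := by
    intro N
    induction N with
    | zero => simp [div_self (ha (i + j))]
    | succ N ih =>
      rw [prod_range_succ, ih, show i + 1 + (j + 1) + (N + 1) - 1 = i + j + (N + 1) + 1 by omega,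
        show i + 1 + (j + 1) + (N + 1) - 2 = i + j + N + 1 by omega, mul_comm,
        div_mul_div_cancel₀ (ha (i + j + N))]
  rw [tele, mul_assoc, mul_assoc, ← pow_add, ← pow_add]
  congr 4 <;> ring

/-- **Kamioka's norm-trace generating function formula** (Theorem 1.1):
for all nonnegative integers `r, c, n`,
`Σ_{π ∈ P(r,c,n)} q^{|π|} a^{tr(π)} ∏_{k=1}^{π_{1,1}} (q^{n-k+1};q)_{D_k(π)} / (a q^{n-k+1};q)_{D_k(π)}`
`= ∏_{i=1}^r ∏_{j=1}^c ∏_{k=1}^n (1 - a q^{i+j+k-1})/(1 - a q^{i+j+k-2})` in `ℚ(a,q)`. -/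
theorem kamioka_norm_trace (r c n : ℕ) :
    (∑ᶠ π ∈ boxPP r c n,
      qv ^ ppNorm π * av ^ ppTrace π *
        ∏ k ∈ Finset.Icc 1 (π 1 1),
          poch (qv ^ (n - k + 1)) qv (durfee π k) /
            poch (av * qv ^ (n - k + 1)) qv (durfee π k)) =
    ∏ i ∈ Finset.Icc 1 r, ∏ j ∈ Finset.Icc 1 c, ∏ k ∈ Finset.Icc 1 n,
      (1 - av * qv ^ (i + j + k - 1)) / (1 - av * qv ^ (i + j + k - 2)) := by
  have hM : r ≤ r + c + 1 := by omega
  have hM' : c ≤ r + c + 1 := by omega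
  rw [← prod_range_sliceFactor one_sub_av_mul_qv_pow_ne_zero,
    ← sum_central qv_ne_zero one_sub_qv_pow_ne_zero (n := n) (Nat.le_add_left c r)
      (Nat.le_add_right r c) av_ne_zero one_sub_av_mul_qv_pow_ne_zero,
    sum_congr rfl fun lam _ => by
      rw [halfSum_eq_sum_chains qv hM, halfSum_eq_sum_chains qv hM', mul_right_comm, mul_assoc,
        sum_mul_sum, ← sum_product', mul_sum],
    sum_sigma', ← finsum_mem_coe_finset]
  refine finsum_mem_eq_of_bijOn slices (slices_bijOn hM) fun p hp => ?_
  rw [prod_durfee_eq av qv hp hM, ppNorm_eq hp.1 hM hM', ppTrace_eq hp.1 hM]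
  simp only [slices, seqWeight, sizePow, prod_mul_distrib, prod_pow_eq_pow_sum, mul_pow, pow_add]
  ring

end
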